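/- Let k be a nonnegative integer, let G be a finite simple graph with n ≥ 1 vertices, let 𝒯 = (T, {X_t}) be a rooted tree decomposition of G with μ(𝒯) ≤ k, and let t be a node of T. Then the number of distinct signatures at t of maximal induced forests of G is at most (12k)^{12k} · n^{14k+2}; that is, the set {(F ∩ X_t, π_F) : F a maximal induced forest in G}, where π_F is the partition of F ∩ X_t in which two vertices lie in the same block iff they are connected by a path in G[F ∩ V_t], has at most (12k)^{12k} · n^{14k+2} elements. -/

import Mathlib

open SimpleGraph

namespace Paper

/-- A tree decomposition of a graph `G`. -/
structure TreeDecomp {V : Type} (G : SimpleGraph V) where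
  ι : Type
  fin : Fintype ι
  tree : SimpleGraph ι
  isTree : tree.IsTree
  bag : ι → Set V
  mem_bag : ∀ v : V, ∃ t, v ∈ bag t
  edge_bag : ∀ ⦃u w : V⦄, G.Adj u w → ∃ t, u ∈ bag t ∧ w ∈ bag t
  coherent : ∀ v : V, (tree.induce {t | v ∈ bag t}).Connected

/-- `M` is an induced matching in `G`: a set of edges, pairwise disjoint,
with no edge of `G` joining endpoints of distinct edges of `M`. -/
def IsInducedMatching {V : Type} (G : SimpleGraph V) (M : Finset (V × V)) : Prop :=
  (∀ p ∈ M, G.Adj p.1 p.2) ∧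
    ∀ p ∈ M, ∀ q ∈ M, p ≠ q →
      (p.1 ≠ q.1 ∧ p.1 ≠ q.2 ∧ p.2 ≠ q.1 ∧ p.2 ≠ q.2) ∧
      (¬ G.Adj p.1 q.1 ∧ ¬ G.Adj p.1 q.2 ∧ ¬ G.Adj p.2 q.1 ∧ ¬ G.Adj p.2 q.2)

/-- Every edge of `M` has an endpoint in `X`. -/
def Touches {V : Type} (M : Finset (V × V)) (X : Set V) : Prop :=
  ∀ p ∈ M, p.1 ∈ X ∨ p.2 ∈ X

/-- μ(𝒯): the maximum size of an induced matching of `G` all of whose edges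
touch a common bag of the tree decomposition `D`. -/
noncomputable def mu {V : Type} (G : SimpleGraph V) (D : TreeDecomp G) : ℕ :=
  sSup {n | ∃ (t : D.ι) (M : Finset (V × V)),
    IsInducedMatching G M ∧ Touches M (D.bag t) ∧ M.card = n}

/-- Induced matching treewidth: minimum of μ(𝒯) over tree decompositions. -/
noncomputable def treeMu {V : Type} (G : SimpleGraph V) : ℕ :=
  sInf {n | ∃ D : TreeDecomp G, mu G D = n}

/-- `S` is an independent set of `G`. -/
def IsIndepSet {V : Type} (G : SimpleGraph V) (S : Finset V) : Prop :=
  ∀ u ∈ S, ∀ v ∈ S, u ≠ v → ¬ G.Adj u v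

/-- α(𝒯): the maximum size of an independent set of `G` contained in a bag. -/
noncomputable def alphaTD {V : Type} (G : SimpleGraph V) (D : TreeDecomp G) : ℕ :=
  sSup {n | ∃ (t : D.ι) (S : Finset V),
    IsIndepSet G S ∧ ↑S ⊆ D.bag t ∧ S.card = n}

/-- Tree-independence number: minimum of α(𝒯) over tree decompositions. -/
noncomputable def treeAlpha {V : Type} (G : SimpleGraph V) : ℕ :=
  sInf {n | ∃ D : TreeDecomp G, alphaTD G D = n}

/-- The `k`-th power of `G`: distinct vertices adjacent iff their distance in `G`
is at most `k` (for `k = 0` this is the edgeless graph). -/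
def power {V : Type} (G : SimpleGraph V) (k : ℕ) : SimpleGraph V :=
  SimpleGraph.fromRel (fun u v => G.Reachable u v ∧ G.dist u v ≤ k)

/-- The graph `G°[ℋ]` for a family `ℋ = {H j}` of subgraphs of `G`: vertices are
indices `j`, two distinct indices adjacent iff the subgraphs share a vertex or
there is an edge of `G` between them. -/
def blowup {V J : Type} (G : SimpleGraph V) (H : J → G.Subgraph) : SimpleGraph J :=
  SimpleGraph.fromRel (fun i j =>
    ((H i).verts ∩ (H j).verts).Nonempty ∨
      ∃ u ∈ (H i).verts, ∃ v ∈ (H j).verts, G.Adj u v)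


/-- `F` induces a forest in `G` and is inclusion-wise maximal with this property. -/
def IsMaximalInducedForest {V : Type} (G : SimpleGraph V) (F : Set V) : Prop :=
  (G.induce F).IsAcyclic ∧
    ∀ F' : Set V, F ⊆ F' → (G.induce F').IsAcyclic → F' = F

/-- `a` and `b` are joined by a walk of `G` all of whose vertices lie in `S`
(i.e. they are connected in `G[S]`). -/
def ConnectedIn {V : Type} (G : SimpleGraph V) (S : Set V) (a b : V) : Prop :=
  ∃ w : G.Walk a b, ∀ x ∈ w.support, x ∈ S

/-- A depth function for an induced forest. -/
lemma exists_depth {V : Type} (G : SimpleGraph V) (F : Set V) (hF : (G.induce F).IsAcyclic) :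
    ∃ d : V → ℕ,
      (∀ u ∈ F, ∀ v ∈ F, G.Adj u v → d u = d v + 1 ∨ d v = d u + 1) ∧
      (∀ u₁ ∈ F, ∀ u₂ ∈ F, ∀ v ∈ F, G.Adj u₁ v → G.Adj u₂ v → d v = d u₁ + 1 →
        d v = d u₂ + 1 → u₁ = u₂) := by
  classical
  set H := G.induce F with hH
  let r : F → F := fun v => (H.connectedComponentMk v).out
  have hr : ∀ v, H.Reachable (r v) v := fun v => by
    apply SimpleGraph.ConnectedComponent.exact
    exact Quot.out_eq _
  have hradj : ∀ u v, H.Adj u v → r u = r v := fun u v h => by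
    have : H.connectedComponentMk u = H.connectedComponentMk v :=
      SimpleGraph.ConnectedComponent.sound h.reachable
    simp only [r, this]
  let d : V → ℕ := fun v => if h : v ∈ F then H.dist (r ⟨v, h⟩) ⟨v, h⟩ else 0
  have hd : ∀ v (h : v ∈ F), d v = H.dist (r ⟨v, h⟩) ⟨v, h⟩ := fun v h => by simp [d, h]
  refine ⟨d, ?_, ?_⟩
  · intro u hu v hv huv
    have ha : H.Adj ⟨u, hu⟩ ⟨v, hv⟩ := huv
    rw [hd u hu, hd v hv, ← hradj _ _ ha]
    exact hF.dist_eq_dist_add_one_of_adj_of_reachable _ ha (hr _)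
  · intro u₁ h₁ u₂ h₂ v hv a₁ a₂ e₁ e₂
    have b₁ : H.Adj ⟨u₁, h₁⟩ ⟨v, hv⟩ := a₁
    have b₂ : H.Adj ⟨u₂, h₂⟩ ⟨v, hv⟩ := a₂
    obtain ⟨q, hq, hq'⟩ := (hr ⟨v, hv⟩).exists_path_of_dist
    have key : ∀ u (hu : u ∈ F), H.Adj ⟨u, hu⟩ ⟨v, hv⟩ → d v = d u + 1 →
        (⟨u, hu⟩ : F) = q.penultimate := by
      intro u hu b e
      rw [hd u hu, hd v hv, hradj _ _ b] at e
      have hru : H.Reachable (r ⟨v, hv⟩) ⟨u, hu⟩ := (hr _).trans b.symm.reachable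
      obtain ⟨p, hp, hp'⟩ := hru.exists_path_of_dist
      apply hF.eq_penultimate_of_adj_end hq b.symm
      apply hF.mem_support_of_ne_mem_support_of_adj_of_isPath hq hp b.symm
      intro hmem
      have := hF.path_concat hq hp b.symm hmem
      have h2 : p.length = q.length + 1 := by rw [this, SimpleGraph.Walk.length_concat]
      omega
    have := (key u₁ h₁ b₁ e₁).trans (key u₂ h₂ b₂ e₂).symm
    exact congrArg Subtype.val this

/-- A vertex outside of a maximal induced forest has two distinct neighbours in it. -/
lemma two_neighbours {V : Type} (G : SimpleGraph V) (F : Set V)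
    (hF : IsMaximalInducedForest G F) (v : V) (hv : v ∉ F) :
    ∃ x ∈ F, ∃ y ∈ F, x ≠ y ∧ G.Adj v x ∧ G.Adj v y := by
  classical
  by_contra hcon
  push Not at hcon
  have hac : (G.induce (insert v F)).IsAcyclic := by
    intro a c hc
    let φ := (SimpleGraph.Embedding.induce (G := G) (insert v F)).toHom
    have hφ : Function.Injective φ := (SimpleGraph.Embedding.induce (G := G) (insert v F)).injective
    have hcm : (c.map φ).IsCycle := hc.map hφ
    have hsup : ∀ x ∈ (c.map φ).support, x ∈ insert v F := by
      intro x hx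
      rw [SimpleGraph.Walk.support_map, List.mem_map] at hx
      obtain ⟨y, _, rfl⟩ := hx
      exact y.2
    generalize c.map φ = c' at hcm hsup
    by_cases hvc : v ∈ c'.support
    · have hc2 := hcm.rotate hvc
      have hs2 : ∀ x ∈ (c'.rotate v hvc).support, x ∈ insert v F := by
        intro x hx
        apply hsup
        simpa using hx
      generalize c'.rotate v hvc = c2 at hc2 hs2
      have hnn := hc2.not_nil
      have a1 := c2.adj_snd hnn
      have a2 := (c2.adj_penultimate hnn).symm
      have m1 := hs2 _ (c2.getVert_mem_support 1)
      have m2 := hs2 _ (c2.getVert_mem_support (c2.length - 1))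
      have m1' : c2.snd ∈ F := m1.resolve_left a1.ne'
      have m2' : c2.penultimate ∈ F := m2.resolve_left a2.ne'
      exact hcon _ m1' _ m2' hc2.snd_ne_penultimate a1 a2
    · have hs3 : ∀ x ∈ c'.support, x ∈ F := fun x hx =>
        (hsup x hx).resolve_left (fun h => hvc (h ▸ hx))
      have := hF.1 (c'.induce F hs3)
      apply this
      have h4 : ((c'.induce F hs3).map (SimpleGraph.Embedding.induce (G := G) F).toHom).IsCycle := by
        rw [SimpleGraph.Walk.map_induce]; exact hcm
      exact h4.of_map
  have := hF.2 _ (Set.subset_insert v F) hac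
  exact hv (this ▸ Set.mem_insert v F)

/-- `J` behaves like a maximal independent set with respect to `Y`, and semi-induced matchings
between `J` and `Y \ J` have size at most `m`. -/
structure Good {V : Type} (G : SimpleGraph V) (O : Set V) (L : List V) (Y : Set V) (m : ℕ)
    (J : Set V) : Prop where
  sub : ∀ x ∈ J, x ∈ O ∨ x ∈ Y
  mem : ∀ x ∈ J, x ∈ L
  indep : ∀ v ∈ Y, v ∈ J → ∀ x ∈ J, ¬ G.Adj v x
  dom : ∀ v ∈ Y, v ∉ J → ∃ x ∈ J, G.Adj v x
  rank : ∀ M : Finset (V × V),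
    (∀ p ∈ M, p.1 ∈ J ∧ p.2 ∈ Y ∧ p.2 ∉ J ∧ G.Adj p.1 p.2) →
    (∀ p ∈ M, ∀ q ∈ M, p ≠ q → ¬ G.Adj p.1 q.2 ∧ ¬ G.Adj p.2 q.2) → M.card ≤ m

/-- The number of traces of good sets. -/
lemma trace_count {V : Type} [Fintype V] (G : SimpleGraph V) (O : Set V) :
    ∀ (L : List V), L.Pairwise (fun a b => b ∈ O → a ∈ O) →
    ∀ (Y : Set V) (m : ℕ), Disjoint Y O →
      {T : Set V | ∃ J, Good G O L Y m J ∧ T = J ∩ Y}.ncard ≤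
        (1 + L.length * Fintype.card V) ^ m := by
  classical
  intro L
  induction L with
  | nil =>
    intro _ Y m _
    have : {T : Set V | ∃ J, Good G O [] Y m J ∧ T = J ∩ Y} ⊆ {∅} := by
      rintro T ⟨J, hJ, rfl⟩
      have : J = ∅ := by
        ext x; constructor
        · intro hx; exact absurd (hJ.mem x hx) (by simp)
        · intro hx; exact hx.elim
      simp [this]
    calc _ ≤ ({∅} : Set (Set V)).ncard := Set.ncard_le_ncard this
      _ = 1 := Set.ncard_singleton _
      _ ≤ _ := by simp
  | cons a L ih =>
    intro hL Y m hYO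
    rw [List.pairwise_cons] at hL
    obtain ⟨hLa, hL⟩ := hL
    let Tr : Set V → ℕ → Set (Set V) := fun Y m => {T : Set V | ∃ J, Good G O L Y m J ∧ T = J ∩ Y}
    let g : Set V → Set V := fun T =>
      if a ∈ Y ∧ ∀ x ∈ T, ¬ G.Adj a x then insert a T else T
    let h : Set V → Set V := fun T => if a ∈ Y then insert a T else T
    let Y1 : Set V := Y \ {a}
    let Y2 : V → Set V := fun u => {v | v ∈ Y ∧ v ≠ a ∧ ¬ G.Adj a v ∧ ¬ G.Adj u v}
    have hY1 : Disjoint Y1 O := hYO.mono_left Set.sdiff_subset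
    have hY2 : ∀ u, Disjoint (Y2 u) O := fun u => hYO.mono_left (fun v hv => hv.1)
    -- no private neighbour
    have case1 : ∀ J, Good G O (a :: L) Y m J →
        (∀ u ∈ Y, u ∉ J → a ∈ J → ∃ x ∈ J, x ≠ a ∧ G.Adj u x) →
        J ∩ Y ∈ g '' Tr Y1 m := by
      intro J hJ hnp
      refine ⟨(J \ {a}) ∩ Y1, ⟨J \ {a}, ?_, rfl⟩, ?_⟩
      · constructor
        · rintro x ⟨hx, hxa⟩
          exact (hJ.sub x hx).imp id (fun h => ⟨h, hxa⟩)
        · rintro x ⟨hx, hxa⟩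
          exact (List.mem_cons.1 (hJ.mem x hx)).resolve_left hxa
        · rintro v ⟨hv, _⟩ ⟨hvJ, _⟩ x ⟨hx, _⟩
          exact hJ.indep v hv hvJ x hx
        · rintro v ⟨hv, hva⟩ hvJ
          have hvJ' : v ∉ J := fun h => hvJ ⟨h, hva⟩
          by_cases haJ : a ∈ J
          · obtain ⟨x, hx, hxa, hadj⟩ := hnp v hv hvJ' haJ
            exact ⟨x, ⟨hx, hxa⟩, hadj⟩
          · obtain ⟨x, hx, hadj⟩ := hJ.dom v hv hvJ'
            exact ⟨x, ⟨hx, fun h => haJ (h ▸ hx)⟩, hadj⟩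
        · intro M hM hM'
          refine hJ.rank M (fun p hp => ?_) hM'
          obtain ⟨h1, h2, h3, h4⟩ := hM p hp
          exact ⟨h1.1, h2.1, fun h => h3 ⟨h, h2.2⟩, h4⟩
      · by_cases haY : a ∈ Y
        · have haO : a ∉ O := fun h => (Set.disjoint_left.1 hYO haY h)
          have hJY : ∀ x ∈ J, x ∈ Y := by
            intro x hx
            rcases hJ.sub x hx with h | h
            · rcases List.mem_cons.1 (hJ.mem x hx) with e | e
              · exact e ▸ haY
              · exact absurd (hLa x e h) haO
            · exact h
          by_cases haJ : a ∈ J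
          · have : a ∈ Y ∧ ∀ x ∈ (J \ {a}) ∩ Y1, ¬ G.Adj a x :=
              ⟨haY, fun x hx => hJ.indep a haY haJ x hx.1.1⟩
            simp only [g, if_pos this]
            ext x
            simp only [Set.mem_insert_iff, Set.mem_inter_iff, Set.mem_sdiff, Set.mem_singleton_iff, Y1]
            by_cases hxa : x = a
            · subst hxa; simp [haJ, haY]
            · simp [hxa]
          · have : ¬ (a ∈ Y ∧ ∀ x ∈ (J \ {a}) ∩ Y1, ¬ G.Adj a x) := by
              rintro ⟨_, hh⟩
              obtain ⟨x, hx, hadj⟩ := hJ.dom a haY haJ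
              have hxa : x ≠ a := fun h => haJ (h ▸ hx)
              exact hh x ⟨⟨hx, hxa⟩, hJY x hx, hxa⟩ hadj
            simp only [g, if_neg this]
            ext x
            simp only [Set.mem_inter_iff, Set.mem_sdiff, Set.mem_singleton_iff, Y1]
            by_cases hxa : x = a
            · subst hxa; simp [haJ]
            · simp [hxa]
        · have : ¬ (a ∈ Y ∧ ∀ x ∈ (J \ {a}) ∩ Y1, ¬ G.Adj a x) := fun h => haY h.1
          simp only [g, if_neg this]
          ext x
          simp only [Set.mem_inter_iff, Set.mem_sdiff, Set.mem_singleton_iff, Y1]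
          by_cases hxa : x = a
          · subst hxa; simp [haY]
          · simp [hxa]
    -- private neighbour `u`
    have case2 : ∀ J, Good G O (a :: L) Y m J → ∀ u ∈ Y, u ∉ J → a ∈ J →
        (∀ x ∈ J, G.Adj u x → x = a) → 1 ≤ m ∧ J ∩ Y ∈ h '' Tr (Y2 u) (m - 1) := by
      intro J hJ u huY huJ haJ hpriv
      have hau : G.Adj a u := by
        obtain ⟨x, hx, hadj⟩ := hJ.dom u huY huJ
        exact (hpriv x hx hadj) ▸ hadj.symm
      have hext : ∀ M : Finset (V × V),
          (∀ p ∈ M, p.1 ∈ J \ {a} ∧ p.2 ∈ Y2 u ∧ p.2 ∉ J \ {a} ∧ G.Adj p.1 p.2) →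
          (∀ p ∈ M, ∀ q ∈ M, p ≠ q → ¬ G.Adj p.1 q.2 ∧ ¬ G.Adj p.2 q.2) → M.card + 1 ≤ m := by
        intro M hM hM'
        have hnot : (a, u) ∉ M := fun hmem => (hM _ hmem).1.2 rfl
        rw [← Finset.card_insert_of_notMem hnot]
        apply hJ.rank
        · intro p hp
          rcases Finset.mem_insert.1 hp with rfl | hp
          · exact ⟨haJ, huY, huJ, hau⟩
          · obtain ⟨h1, h2, h3, h4⟩ := hM p hp
            exact ⟨h1.1, h2.1, fun h => h3 ⟨h, h2.2.1⟩, h4⟩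
        · intro p hp q hq hpq
          rcases Finset.mem_insert.1 hp with rfl | hp <;>
            rcases Finset.mem_insert.1 hq with rfl | hq
          · exact absurd rfl hpq
          · obtain ⟨h1, h2, h3, h4⟩ := hM q hq
            exact ⟨h2.2.2.1, h2.2.2.2⟩
          · obtain ⟨h1, h2, h3, h4⟩ := hM p hp
            exact ⟨fun h => h1.2 (hpriv _ h1.1 h.symm), fun h => h2.2.2.2 h.symm⟩
          · exact hM' p hp q hq hpq
      have hm : 1 ≤ m := by simpa using hext ∅ (by simp) (by simp)
      refine ⟨hm, (J \ {a}) ∩ Y2 u, ⟨J \ {a}, ?_, rfl⟩, ?_⟩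
      · constructor
        · rintro x ⟨hx, hxa⟩
          exact (hJ.sub x hx).imp id (fun h => ⟨h, hxa, fun h' => hJ.indep x h hx a haJ h'.symm,
            fun h' => hxa (hpriv x hx h')⟩)
        · rintro x ⟨hx, hxa⟩
          exact (List.mem_cons.1 (hJ.mem x hx)).resolve_left hxa
        · rintro v ⟨hv, _⟩ ⟨hvJ, _⟩ x ⟨hx, _⟩
          exact hJ.indep v hv hvJ x hx
        · rintro v ⟨hv, hva, hav, huv⟩ hvJ
          have hvJ' : v ∉ J := fun h => hvJ ⟨h, hva⟩
          obtain ⟨x, hx, hadj⟩ := hJ.dom v hv hvJ'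
          exact ⟨x, ⟨hx, fun h => hav (by rw [← show x = a from h]; exact hadj.symm)⟩, hadj⟩
        · intro M hM hM'
          have := hext M hM hM'
          omega
      · have key : ∀ x, x ≠ a → (x ∈ J ∧ x ∈ Y ↔ (x ∈ J \ {a} ∧ x ∈ Y2 u)) := by
          intro x hxa
          constructor
          · rintro ⟨h1, h2⟩
            exact ⟨⟨h1, hxa⟩, h2, hxa, fun h' => hJ.indep x h2 h1 a haJ h'.symm,
              fun h' => hxa (hpriv x h1 h')⟩
          · rintro ⟨h1, h2⟩
            exact ⟨h1.1, h2.1⟩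
        by_cases haY : a ∈ Y
        · simp only [h, if_pos haY]
          ext x
          by_cases hxa : x = a
          · subst hxa; simp [haJ, haY]
          · simp only [Set.mem_insert_iff, hxa, false_or, Set.mem_inter_iff]
            exact (key x hxa).symm
        · simp only [h, if_neg haY]
          ext x
          by_cases hxa : x = a
          · subst hxa; simp [haY]
          · simp only [Set.mem_inter_iff]
            exact (key x hxa).symm
    have hsplit : ∀ J, Good G O (a :: L) Y m J → J ∩ Y ∈ g '' Tr Y1 m ∨
        (1 ≤ m ∧ ∃ u, J ∩ Y ∈ h '' Tr (Y2 u) (m - 1)) := by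
      intro J hJ
      by_cases hp : ∀ u ∈ Y, u ∉ J → a ∈ J → ∃ x ∈ J, x ≠ a ∧ G.Adj u x
      · exact Or.inl (case1 J hJ hp)
      · push Not at hp
        obtain ⟨u, huY, huJ, haJ, hx⟩ := hp
        have := case2 J hJ u huY huJ haJ
          (fun x hxJ hadj => by by_contra hne; exact hx x hxJ hne hadj)
        exact Or.inr ⟨this.1, u, this.2⟩
    have ih1 : (g '' Tr Y1 m).ncard ≤ (1 + L.length * Fintype.card V) ^ m :=
      (Set.ncard_image_le (Set.toFinite _)).trans (ih hL Y1 m hY1)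
    rcases Nat.eq_zero_or_pos m with rfl | hm
    · calc _ ≤ (g '' Tr Y1 0).ncard := by
            refine Set.ncard_le_ncard ?_ (Set.toFinite _)
            rintro T ⟨J, hJ, rfl⟩
            rcases hsplit J hJ with h | ⟨h, _⟩
            · exact h
            · omega
        _ ≤ _ := by simpa using ih1
    · obtain ⟨m, rfl⟩ : ∃ m', m = m' + 1 := ⟨m - 1, by omega⟩
      simp only [Nat.add_sub_cancel] at hsplit
      have ih2 : ∀ u, (h '' Tr (Y2 u) m).ncard ≤ (1 + L.length * Fintype.card V) ^ m := fun u =>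
        (Set.ncard_image_le (Set.toFinite _)).trans (ih hL (Y2 u) m (hY2 u))
      calc _ ≤ (g '' Tr Y1 (m + 1) ∪ ⋃ u ∈ (Finset.univ : Finset V), h '' Tr (Y2 u) m).ncard := by
            refine Set.ncard_le_ncard ?_ (Set.toFinite _)
            rintro T ⟨J, hJ, rfl⟩
            rcases hsplit J hJ with h | ⟨_, u, h⟩
            · exact Or.inl h
            · refine Or.inr ?_
              simp only [Set.mem_iUnion]
              exact ⟨u, Finset.mem_univ _, h⟩
        _ ≤ (g '' Tr Y1 (m + 1)).ncard + (⋃ u ∈ (Finset.univ : Finset V), h '' Tr (Y2 u) m).ncard :=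
            Set.ncard_union_le _ _
        _ ≤ (1 + L.length * Fintype.card V) ^ (m + 1) +
              ∑ u : V, (h '' Tr (Y2 u) m).ncard :=
            Nat.add_le_add ih1 (Finset.set_ncard_biUnion_le _ _)
        _ ≤ (1 + L.length * Fintype.card V) ^ (m + 1) +
              ∑ u : V, (1 + L.length * Fintype.card V) ^ m :=
            Nat.add_le_add_left (Finset.sum_le_sum fun u _ => ih2 u) _
        _ = (1 + (a :: L).length * Fintype.card V) * (1 + L.length * Fintype.card V) ^ m := by
            simp only [Finset.sum_const, Finset.card_univ, smul_eq_mul, List.length_cons]; ring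
        _ ≤ (1 + (a :: L).length * Fintype.card V) ^ (m + 1) := by
            rw [pow_succ' (1 + (a :: L).length * Fintype.card V)]
            apply Nat.mul_le_mul_left
            apply Nat.pow_le_pow_left
            simp only [List.length_cons]
            gcongr
            omega

lemma card_le_of_mu {V : Type} [Fintype V] (k : ℕ) (G : SimpleGraph V)
    (D : TreeDecomp G) (hmu : mu G D ≤ k) (t : D.ι) (M : Finset (V × V))
    (hM : IsInducedMatching G M) (hT : Touches M (D.bag t)) : M.card ≤ k := by
  classical
  refine le_trans (le_csSup ?_ ?_) hmu
  · refine ⟨Fintype.card (V × V), ?_⟩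
    rintro n ⟨_, M, _, _, rfl⟩
    exact Finset.card_le_univ M
  · exact ⟨t, M, hM, hT, rfl⟩

/-- The skeleton of an induced forest with respect to `X`. -/
lemma exists_skeleton {V : Type} [Fintype V] (k : ℕ) (G : SimpleGraph V) (X : Set V)
    (hk : ∀ M : Finset (V × V), IsInducedMatching G M → Touches M X → M.card ≤ k)
    (F : Set V) (hne : F.Nonempty) (d : V → ℕ)
    (hd1 : ∀ u ∈ F, ∀ v ∈ F, G.Adj u v → d u = d v + 1 ∨ d v = d u + 1)
    (hd2 : ∀ u₁ ∈ F, ∀ u₂ ∈ F, ∀ v ∈ F, G.Adj u₁ v → G.Adj u₂ v → d v = d u₁ + 1 →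
        d v = d u₂ + 1 → u₁ = u₂) :
    ∃ s : Fin (9 * k) → V, (∀ i, s i ∈ F) ∧ ∀ v ∈ F, v ∈ X → v ∉ Set.range s →
      (∀ w ∈ F, G.Adj v w → w ∈ Set.range s) ∧
      (∀ w ∈ F, ∀ w' ∈ F, G.Adj v w → G.Adj v w' → w = w') := by
  classical
  let P : Finset (V × V) → Prop := fun M =>
    (∀ p ∈ M, p.1 ∈ F ∧ p.2 ∈ F ∧ G.Adj p.1 p.2 ∧ d p.2 = d p.1 + 1 ∧ (p.1 ∈ X ∨ p.2 ∈ X)) ∧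
    ∀ p ∈ M, ∀ q ∈ M, p ≠ q → p.1 ≠ q.1 ∧ p.1 ≠ q.2 ∧ p.2 ≠ q.1 ∧ p.2 ≠ q.2
  obtain ⟨M, hM⟩ := (Set.toFinite {M | P M}).exists_maximal ⟨∅, by simp [P]⟩
  obtain ⟨hM1, hM2⟩ : P M := hM.prop
  have hcard : M.card ≤ k * 3 := by
    have := Finset.card_le_mul_card_image_of_maps_to (s := M) (t := Finset.range 3)
      (f := fun p => d p.1 % 3) (fun p _ => Finset.mem_range.2 (Nat.mod_lt _ (by norm_num))) k ?_
    · simpa using this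
    · intro c _
      apply hk
      · refine ⟨fun p hp => (hM1 p (Finset.mem_filter.1 hp).1).2.2.1, ?_⟩
        intro p hp q hq hpq
        obtain ⟨hp, hpc⟩ := Finset.mem_filter.1 hp
        obtain ⟨hq, hqc⟩ := Finset.mem_filter.1 hq
        obtain ⟨p1, p2, p3, p4, _⟩ := hM1 p hp
        obtain ⟨q1, q2, q3, q4, _⟩ := hM1 q hq
        have hdis := hM2 p hp q hq hpq
        refine ⟨hdis, ?_, ?_, ?_, ?_⟩
        · intro h
          have := hd1 _ p1 _ q1 h
          omega
        · intro h
          have h1 := hd1 _ p1 _ q2 h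
          exact hdis.1 (hd2 _ p1 _ q1 _ q2 h q3 (by omega) q4)
        · intro h
          have h1 := hd1 _ p2 _ q1 h
          exact hdis.1 (hd2 _ p1 _ q1 _ p2 p3 h.symm p4 (by omega))
        · intro h
          have := hd1 _ p2 _ q2 h
          omega
      · intro p hp
        exact (hM1 p (Finset.mem_filter.1 hp).1).2.2.2.2
  let par : V → V := fun x =>
    if h : ∃ y ∈ F, G.Adj y x ∧ d x = d y + 1 then h.choose else x
  have hpar1 : ∀ x ∈ F, par x ∈ F := by
    intro x hx
    by_cases h : ∃ y ∈ F, G.Adj y x ∧ d x = d y + 1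
    · simp only [par, dif_pos h]; exact h.choose_spec.1
    · simp only [par, dif_neg h]; exact hx
  have hpar2 : ∀ x ∈ F, ∀ y ∈ F, G.Adj y x → d x = d y + 1 → par x = y := by
    intro x hx y hy hadj hdd
    have h : ∃ y ∈ F, G.Adj y x ∧ d x = d y + 1 := ⟨y, hy, hadj, hdd⟩
    simp only [par, dif_pos h]
    exact hd2 _ h.choose_spec.1 _ hy _ hx h.choose_spec.2.1 hadj h.choose_spec.2.2 hdd
  let S : Finset V := M.biUnion (fun p => {p.1, p.2, par p.1})
  have hS : ∀ p ∈ M, p.1 ∈ S ∧ p.2 ∈ S ∧ par p.1 ∈ S := by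
    intro p hp
    simp only [S, Finset.mem_biUnion]
    exact ⟨⟨p, hp, by simp⟩, ⟨p, hp, by simp⟩, ⟨p, hp, by simp⟩⟩
  have hSF : ∀ x ∈ S, x ∈ F := by
    intro x hx
    simp only [S, Finset.mem_biUnion] at hx
    obtain ⟨p, hp, hx⟩ := hx
    obtain ⟨p1, p2, p3, p4, _⟩ := hM1 p hp
    simp only [Finset.mem_insert, Finset.mem_singleton] at hx
    rcases hx with rfl | rfl | rfl
    · exact p1
    · exact p2
    · exact hpar1 _ p1
  have hScard : S.card ≤ 9 * k := by
    have : S.card ≤ M.card * 3 :=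
      Finset.card_biUnion_le_card_mul _ _ _ (fun p _ => Finset.card_le_three)
    omega
  obtain ⟨f0, hf0⟩ := hne
  let s : Fin (9 * k) → V := fun i => S.toList.getD i f0
  have hsS : ∀ x ∈ S, x ∈ Set.range s := by
    intro x hx
    obtain ⟨i, hi, hix⟩ := List.getElem_of_mem (Finset.mem_toList.2 hx)
    have hi' : i < 9 * k := lt_of_lt_of_le (by simpa using hi) hScard
    refine ⟨⟨i, hi'⟩, ?_⟩
    simp only [s, List.getD_eq_getElem _ _ hi, hix]
  refine ⟨s, ?_, ?_⟩
  · intro i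
    by_cases hi : (i : ℕ) < S.toList.length
    · simp only [s, List.getD_eq_getElem _ _ hi]
      exact hSF _ (Finset.mem_toList.1 (List.getElem_mem _))
    · simp only [s, List.getD_eq_default _ _ (not_lt.1 hi)]
      exact hf0
  · intro v hvF hvX hvs
    have hvS : v ∉ S := fun h => hvs (hsS v h)
    -- every forest neighbour of `v` is an endpoint of an edge of `M`
    have hcov : ∀ w ∈ F, G.Adj v w → ∃ p ∈ M, w = p.1 ∨ w = p.2 := by
      intro w hwF hadj
      by_contra hcon
      push Not at hcon
      have hvM : ∀ p ∈ M, v ≠ p.1 ∧ v ≠ p.2 := fun p hp =>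
        ⟨fun h => hvS (h ▸ (hS p hp).1), fun h => hvS (h ▸ (hS p hp).2.1)⟩
      have main : ∀ a b, a ∈ F → b ∈ F → G.Adj a b → d b = d a + 1 → (a ∈ X ∨ b ∈ X) →
          (∀ p ∈ M, a ≠ p.1 ∧ a ≠ p.2) → (∀ p ∈ M, b ≠ p.1 ∧ b ≠ p.2) → False := by
        intro a b ha hb hab hdd hX haM hbM
        have hP : P (insert (a, b) M) := by
          constructor
          · intro p hp
            rcases Finset.mem_insert.1 hp with rfl | hp
            · exact ⟨ha, hb, hab, hdd, hX⟩
            · exact hM1 p hp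
          · intro p hp q hq hpq
            rcases Finset.mem_insert.1 hp with rfl | hp <;>
              rcases Finset.mem_insert.1 hq with rfl | hq
            · exact absurd rfl hpq
            · exact ⟨(haM q hq).1, (haM q hq).2, (hbM q hq).1, (hbM q hq).2⟩
            · exact ⟨(haM p hp).1.symm, (hbM p hp).1.symm, (haM p hp).2.symm, (hbM p hp).2.symm⟩
            · exact hM2 p hp q hq hpq
        have := hM.le_of_ge hP (Finset.subset_insert _ _)
        have hmem : (a, b) ∈ M := this (Finset.mem_insert_self _ _)
        exact (haM _ hmem).1 rfl
      rcases hd1 v hvF w hwF hadj with h | h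
      · exact main w v hwF hvF hadj.symm h (Or.inr hvX) hcon hvM
      · exact main v w hvF hwF hadj h (Or.inl hvX) hvM hcon
    -- no forest neighbour of `v` is a child
    have hlow : ∀ w ∈ F, G.Adj v w → d v = d w + 1 := by
      intro w hwF hadj
      rcases hd1 v hvF w hwF hadj with h | h
      · exact h
      · exfalso
        obtain ⟨p, hp, rfl | rfl⟩ := hcov w hwF hadj
        · exact hvS (hpar2 _ hwF v hvF hadj h ▸ (hS p hp).2.2)
        · obtain ⟨p1, p2, p3, p4, _⟩ := hM1 p hp
          exact hvS (hd2 _ p1 _ hvF _ hwF p3 hadj p4 h ▸ (hS p hp).1)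
    refine ⟨?_, ?_⟩
    · intro w hwF hadj
      obtain ⟨p, hp, rfl | rfl⟩ := hcov w hwF hadj
      · exact hsS _ (hS p hp).1
      · exact hsS _ (hS p hp).2.1
    · intro w hw w' hw' h h'
      exact hd2 _ hw _ hw' _ hvF h.symm h'.symm (hlow w hw h) (hlow w' hw' h')

lemma ConnectedIn.symm' {V : Type} {G : SimpleGraph V} {S : Set V} {a b : V}
    (h : ConnectedIn G S a b) : ConnectedIn G S b a := by
  obtain ⟨w, hw⟩ := h
  exact ⟨w.reverse, fun x hx => hw x (by simpa using hx)⟩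

lemma ConnectedIn.trans' {V : Type} {G : SimpleGraph V} {S : Set V} {a b c : V}
    (h : ConnectedIn G S a b) (h' : ConnectedIn G S b c) : ConnectedIn G S a c := by
  obtain ⟨w, hw⟩ := h
  obtain ⟨w', hw'⟩ := h'
  refine ⟨w.append w', fun x hx => ?_⟩
  rcases (SimpleGraph.Walk.mem_support_append_iff _ _).1 hx with h | h
  · exact hw x h
  · exact hw' x h

lemma ConnectedIn.refl' {V : Type} {G : SimpleGraph V} {S : Set V} {a : V} (h : a ∈ S) :
    ConnectedIn G S a a := ⟨SimpleGraph.Walk.nil, by simpa using h⟩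

lemma ConnectedIn.of_adj {V : Type} {G : SimpleGraph V} {S : Set V} {a b : V} (ha : a ∈ S)
    (hb : b ∈ S) (h : G.Adj a b) : ConnectedIn G S a b :=
  ⟨SimpleGraph.Walk.cons h SimpleGraph.Walk.nil, by
    intro x hx
    simp at hx
    rcases hx with rfl | rfl <;> assumption⟩

lemma ConnectedIn.left {V : Type} {G : SimpleGraph V} {S : Set V} {a b : V}
    (h : ConnectedIn G S a b) : a ∈ S := by
  obtain ⟨w, hw⟩ := h
  exact hw _ w.start_mem_support

lemma ConnectedIn.right {V : Type} {G : SimpleGraph V} {S : Set V} {a b : V}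
    (h : ConnectedIn G S a b) : b ∈ S := h.symm'.left

lemma ConnectedIn.first {V : Type} {G : SimpleGraph V} {S : Set V} {a b : V}
    (h : ConnectedIn G S a b) (hab : a ≠ b) : ∃ c, G.Adj a c ∧ ConnectedIn G S c b := by
  obtain ⟨w, hw⟩ := h
  cases w with
  | nil => exact absurd rfl hab
  | cons hadj w' =>
    exact ⟨_, hadj, w', fun x hx => hw x (by simp [hx])⟩

/-- Connectivity between vertices of `F ∩ X` is determined by the skeleton. -/
lemma connectedIn_iff {V : Type} {G : SimpleGraph V} {F W X : Set V} {m : ℕ} (s : Fin m → V)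
    (c : Fin m → Fin m) (hsF : ∀ i, s i ∈ F)
    (hc : ∀ i j, c i = c j ↔ (i = j ∨ ConnectedIn G (F ∩ W) (s i) (s j)))
    (hcov : ∀ v ∈ F, v ∈ X → v ∉ Set.range s → ∀ w ∈ F, G.Adj v w → w ∈ Set.range s)
    {a b : V} (ha : a ∈ F ∩ X) (hb : b ∈ F ∩ X) :
    ConnectedIn G (F ∩ W) a b ↔ a ∈ W ∧ b ∈ W ∧ (a = b ∨ ∃ i j, (a = s i ∨ G.Adj a (s i)) ∧
      (b = s j ∨ G.Adj b (s j)) ∧ s i ∈ W ∧ s j ∈ W ∧ c i = c j) := by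
  have step : ∀ a b, a ∈ F ∩ X → a ≠ b → ConnectedIn G (F ∩ W) a b →
      ∃ i, (a = s i ∨ G.Adj a (s i)) ∧ ConnectedIn G (F ∩ W) (s i) b := by
    intro a b ha hab h
    by_cases has : a ∈ Set.range s
    · obtain ⟨i, rfl⟩ := has
      exact ⟨i, Or.inl rfl, h⟩
    · obtain ⟨x, hadj, hx⟩ := h.first hab
      obtain ⟨i, rfl⟩ := hcov a ha.1 ha.2 has x hx.left.1 hadj
      exact ⟨i, Or.inr hadj, hx⟩
  constructor
  · intro h
    refine ⟨h.left.2, h.right.2, ?_⟩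
    by_cases hab : a = b
    · exact Or.inl hab
    · right
      obtain ⟨i, hi, h1⟩ := step a b ha hab h
      by_cases hib : s i = b
      · exact ⟨i, i, hi, Or.inl hib.symm, h1.left.2, h1.left.2, rfl⟩
      · obtain ⟨j, hj, h2⟩ := step b (s i) hb (Ne.symm hib) h1.symm'
        exact ⟨i, j, hi, hj, h1.left.2, h2.left.2, (hc i j).2 (Or.inr h2.symm')⟩
  · rintro ⟨haW, hbW, rfl | ⟨i, j, hi, hj, hiW, hjW, hij⟩⟩
    · exact ConnectedIn.refl' ⟨ha.1, haW⟩
    · have h1 : ∀ a i, a ∈ F ∩ W → s i ∈ W → (a = s i ∨ G.Adj a (s i)) →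
          ConnectedIn G (F ∩ W) a (s i) := by
        intro a i ha hi h
        rcases h with rfl | h
        · exact ConnectedIn.refl' ha
        · exact ConnectedIn.of_adj ha ⟨hsF i, hi⟩ h
      have h2 : ConnectedIn G (F ∩ W) (s i) (s j) := by
        rcases (hc i j).1 hij with rfl | h
        · exact ConnectedIn.refl' ⟨hsF i, hiW⟩
        · exact h
      exact ((h1 a i ⟨ha.1, haW⟩ hiW hi).trans' h2).trans' (h1 b j ⟨hb.1, hbW⟩ hjW hj).symm'

lemma exists_classes {V : Type} (G : SimpleGraph V) (S : Set V) {m : ℕ} (s : Fin m → V) :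
    ∃ c : Fin m → Fin m, ∀ i j, c i = c j ↔ (i = j ∨ ConnectedIn G S (s i) (s j)) := by
  let R : Setoid (Fin m) :=
    { r := fun i j => i = j ∨ ConnectedIn G S (s i) (s j)
      iseqv := by
        constructor
        · intro i; exact Or.inl rfl
        · rintro i j (rfl | h)
          · exact Or.inl rfl
          · exact Or.inr h.symm'
        · rintro i j l (rfl | h) (rfl | h')
          · exact Or.inl rfl
          · exact Or.inr h'
          · exact Or.inr h
          · exact Or.inr (h.trans' h') }
  refine ⟨fun i => (Quotient.mk R i).out, fun i j => ?_⟩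
  rw [Quotient.out_inj]
  exact Quotient.eq

/-- A list of all vertices in which those of `O` come first. -/
lemma exists_list {V : Type} [Fintype V] (O : Set V) :
    ∃ L : List V, (∀ v, v ∈ L) ∧ L.length = Fintype.card V ∧
      L.Pairwise (fun a b => b ∈ O → a ∈ O) := by
  classical
  refine ⟨(Finset.univ.filter (· ∈ O)).toList ++ (Finset.univ.filter (· ∉ O)).toList, ?_, ?_, ?_⟩
  · intro v
    by_cases h : v ∈ O <;> simp [h]
  · rw [List.length_append, Finset.length_toList, Finset.length_toList,
      Finset.card_filter_add_card_filter_not, Finset.card_univ]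
  · rw [List.pairwise_append]
    refine ⟨?_, ?_, ?_⟩
    · apply List.pairwise_of_forall_mem_list
      intro a ha b _ _
      simpa using ha
    · apply List.pairwise_of_forall_mem_list
      intro a _ b hb hbO
      simp at hb
      exact absurd hbO hb
    · intro a ha b _ _
      simpa using ha

/-- in a rooted tree decomposition with `μ(𝒯) ≤ k`, the number of
distinct signatures at a node `t` of maximal induced forests of `G` is at most
`(12k)^(12k) · n^(14k+2)`.  Here `V_t` is the union of the bags of the nodes
`t'` in the subtree rooted at `t` (those for which every walk from the root to
`t'` passes through `t`), and the signature of `F` at `t` is the pair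
consisting of `F ∩ X_t` and the partition of `F ∩ X_t` into connected
components of `G[F ∩ V_t]`, encoded as the corresponding equivalence relation
(a set of pairs). -/
theorem stmt19 {V : Type} [Fintype V] [Nonempty V] (k : ℕ) (G : SimpleGraph V)
    (D : TreeDecomp G) (hmu : mu G D ≤ k) (root : D.ι) (t : D.ι) :
    {σ : Set V × Set (V × V) |
      ∃ F : Set V, IsMaximalInducedForest G F ∧
        σ = (F ∩ D.bag t,
          {p : V × V | p.1 ∈ F ∩ D.bag t ∧ p.2 ∈ F ∩ D.bag t ∧
            ConnectedIn G
              (F ∩ {v : V | ∃ t' : D.ι,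
                (∀ w : D.tree.Walk root t', t ∈ w.support) ∧ v ∈ D.bag t'})
              p.1 p.2})}.ncard ≤
      (12 * k) ^ (12 * k) * Fintype.card V ^ (14 * k + 2) := by
  classical
  set X := D.bag t with hX
  set W : Set V := {v : V | ∃ t' : D.ι,
    (∀ w : D.tree.Walk root t', t ∈ w.support) ∧ v ∈ D.bag t'} with hW
  have hk : ∀ M : Finset (V × V), IsInducedMatching G M → Touches M X → M.card ≤ k :=
    fun M h1 h2 => card_le_of_mu k G D hmu t M h1 h2
  obtain ⟨L, hLmem, hLlen, hLpw⟩ := exists_list (V := V) Xᶜ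
  let Y : (Fin (9 * k) → V) → Set V := fun s =>
    {v | v ∈ X ∧ v ∉ Set.range s ∧ ∀ i j, G.Adj v (s i) → G.Adj v (s j) → s i = s j}
  let Tr : (Fin (9 * k) → V) → Set (Set V) := fun s =>
    {T : Set V | ∃ J, Good G Xᶜ L (Y s) (2 * k) J ∧ T = J ∩ Y s}
  let Zf : (Fin (9 * k) → V) → Set V → Set V := fun s T => T ∪ (Set.range s ∩ X)
  let dec : (Fin (9 * k) → V) × (Fin (9 * k) → Fin (9 * k)) → Set V → Set V × Set (V × V) :=
    fun sc T => (Zf sc.1 T, {p : V × V | p.1 ∈ Zf sc.1 T ∧ p.2 ∈ Zf sc.1 T ∧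
      (p.1 ∈ W ∧ p.2 ∈ W ∧ (p.1 = p.2 ∨ ∃ i j, (p.1 = sc.1 i ∨ G.Adj p.1 (sc.1 i)) ∧
        (p.2 = sc.1 j ∨ G.Adj p.2 (sc.1 j)) ∧ sc.1 i ∈ W ∧ sc.1 j ∈ W ∧ sc.2 i = sc.2 j))})
  have hTr : ∀ s, (Tr s).ncard ≤ (1 + Fintype.card V * Fintype.card V) ^ (2 * k) := by
    intro s
    have := trace_count G Xᶜ L hLpw (Y s) (2 * k)
      (Set.disjoint_left.2 (fun v hv hv' => hv' hv.1))
    rwa [hLlen] at this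
  have hmain : ∀ F : Set V, IsMaximalInducedForest G F → ∃ sc, ∃ T ∈ Tr sc.1,
      dec sc T = (F ∩ X, {p : V × V | p.1 ∈ F ∩ X ∧ p.2 ∈ F ∩ X ∧
        ConnectedIn G (F ∩ W) p.1 p.2}) := by
    intro F hF
    have hne : F.Nonempty := by
      by_contra hemp
      rw [Set.not_nonempty_iff_eq_empty] at hemp
      obtain ⟨v⟩ := (inferInstance : Nonempty V)
      obtain ⟨x, hx, _⟩ := two_neighbours G F hF v (by simp [hemp])
      simp [hemp] at hx
    obtain ⟨d, hd1, hd2⟩ := exists_depth G F hF.1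
    obtain ⟨s, hsF, hs⟩ := exists_skeleton k G X hk F hne d hd1 hd2
    obtain ⟨c, hc⟩ := exists_classes G (F ∩ W) s
    have hJY : ∀ x ∈ F, x ∉ Set.range s → x ∈ X → x ∈ Y s := by
      intro x hxF hxs hxX
      exact ⟨hxX, hxs, fun i j hi hj => (hs x hxF hxX hxs).2 _ (hsF i) _ (hsF j) hi hj⟩
    have hgood : Good G Xᶜ L (Y s) (2 * k) (F \ Set.range s) := by
      constructor
      · rintro x ⟨hxF, hxs⟩
        by_cases hxX : x ∈ X
        · exact Or.inr (hJY x hxF hxs hxX)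
        · exact Or.inl hxX
      · intro x _
        exact hLmem x
      · rintro v ⟨hvX, hvs, _⟩ ⟨hvF, _⟩ x ⟨hxF, hxs⟩ hadj
        exact hxs ((hs v hvF hvX hvs).1 x hxF hadj)
      · rintro v ⟨hvX, hvs, hv⟩ hvJ
        have hvF : v ∉ F := fun h => hvJ ⟨h, hvs⟩
        obtain ⟨x, hx, y, hy, hxy, ax, ay⟩ := two_neighbours G F hF v hvF
        by_cases hxs : x ∈ Set.range s
        · by_cases hys : y ∈ Set.range s
          · obtain ⟨i, rfl⟩ := hxs
            obtain ⟨j, rfl⟩ := hys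
            exact absurd (hv i j ax ay) hxy
          · exact ⟨y, ⟨hy, hys⟩, ay⟩
        · exact ⟨x, ⟨hx, hxs⟩, ax⟩
      · intro M hM hM'
        have := Finset.card_le_mul_card_image_of_maps_to (s := M) (t := Finset.range 2)
          (f := fun p => d p.1 % 2)
          (fun p _ => Finset.mem_range.2 (Nat.mod_lt _ (by norm_num))) k ?_
        · rw [Finset.card_range] at this
          omega
        · intro e _
          apply hk
          · refine ⟨fun p hp => (hM p (Finset.mem_filter.1 hp).1).2.2.2, ?_⟩
            intro p hp q hq hpq
            obtain ⟨hp, hpc⟩ := Finset.mem_filter.1 hp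
            obtain ⟨hq, hqc⟩ := Finset.mem_filter.1 hq
            obtain ⟨p1, p2, p3, p4⟩ := hM p hp
            obtain ⟨q1, q2, q3, q4⟩ := hM q hq
            obtain ⟨n1, n2⟩ := hM' p hp q hq hpq
            obtain ⟨n3, n4⟩ := hM' q hq p hp hpq.symm
            refine ⟨⟨?_, ?_, ?_, ?_⟩, ?_, n1, fun h => n3 h.symm, n2⟩
            · intro h; exact n1 (h ▸ q4)
            · intro h; exact q3 (h ▸ p1)
            · intro h; exact p3 (h ▸ q1)
            · intro h; exact n1 (h ▸ p4)
            · intro h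
              have := hd1 _ p1.1 _ q1.1 h
              omega
          · intro p hp
            exact Or.inr (hM p (Finset.mem_filter.1 hp).1).2.1.1
    have hZ : Zf s ((F \ Set.range s) ∩ Y s) = F ∩ X := by
      ext x
      constructor
      · rintro (⟨⟨h1, _⟩, h2⟩ | ⟨⟨i, rfl⟩, h⟩)
        · exact ⟨h1, h2.1⟩
        · exact ⟨hsF i, h⟩
      · rintro ⟨hxF, hxX⟩
        by_cases hxs : x ∈ Set.range s
        · exact Or.inr ⟨hxs, hxX⟩
        · exact Or.inl ⟨⟨hxF, hxs⟩, hJY x hxF hxs hxX⟩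
    refine ⟨(s, c), (F \ Set.range s) ∩ Y s, ⟨_, hgood, rfl⟩, ?_⟩
    simp only [dec, hZ]
    congr 1
    ext p
    simp only [Set.mem_ofPred_eq]
    refine and_congr_right fun h1 => and_congr_right fun h2 => ?_
    exact (connectedIn_iff s c hsF hc (fun v hv hvX hvs => (hs v hv hvX hvs).1) h1 h2).symm
  have hn : 1 ≤ Fintype.card V := Fintype.card_pos
  generalize hN : Fintype.card V = N at *
  calc _ ≤ (⋃ sc ∈ (Finset.univ :
          Finset ((Fin (9 * k) → V) × (Fin (9 * k) → Fin (9 * k)))), dec sc '' Tr sc.1).ncard := by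
        refine Set.ncard_le_ncard ?_ (Set.toFinite _)
        rintro σ ⟨F, hF, rfl⟩
        obtain ⟨sc, T, hT, h⟩ := hmain F hF
        simp only [Set.mem_iUnion]
        exact ⟨sc, Finset.mem_univ _, T, hT, h⟩
    _ ≤ ∑ sc : (Fin (9 * k) → V) × (Fin (9 * k) → Fin (9 * k)), (dec sc '' Tr sc.1).ncard :=
        Finset.set_ncard_biUnion_le _ _
    _ ≤ ∑ sc : (Fin (9 * k) → V) × (Fin (9 * k) → Fin (9 * k)), (1 + N * N) ^ (2 * k) :=
        Finset.sum_le_sum fun sc _ => (Set.ncard_image_le (Set.toFinite _)).trans (hTr sc.1)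
    _ = N ^ (9 * k) * (9 * k) ^ (9 * k) * (1 + N * N) ^ (2 * k) := by
        simp [Fintype.card_prod, hN]
    _ ≤ N ^ (9 * k) * (9 * k) ^ (9 * k) * (2 * (N * N)) ^ (2 * k) := by
        gcongr
        nlinarith
    _ = ((9 * k) ^ (9 * k) * 2 ^ (2 * k)) * N ^ (13 * k) := by
        rw [mul_pow 2 (N * N), mul_pow N N, show 13 * k = 9 * k + (2 * k + 2 * k) by ring,
          pow_add N, pow_add N]
        ring
    _ ≤ (12 * k) ^ (12 * k) * N ^ (14 * k + 2) := by
        apply Nat.mul_le_mul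
        · rcases Nat.eq_zero_or_pos k with rfl | hk0
          · simp
          · calc (9 * k) ^ (9 * k) * 2 ^ (2 * k)
                ≤ (12 * k) ^ (9 * k) * (12 * k) ^ (2 * k) := by
                  gcongr <;> omega
              _ = (12 * k) ^ (11 * k) := by rw [← pow_add]; congr 1; ring
              _ ≤ _ := Nat.pow_le_pow_right (by omega) (by omega)
        · exact Nat.pow_le_pow_right hn (by omega)

end Paper
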